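/- arXiv:2409.06839 — 2 statements merged into one kernel-verified Lean document; each statement's English description precedes it below -/
import Mathlib

section
/- (Derivative of the MSE with respect to a threshold, scalar case.) Let f : ℝ × ℝ → ℝ be a nonnegative measurable function (joint density of (S, X)) such that (s,x) ↦ (1+s²)f(s,x) is integrable, x ↦ f(s,x) is continuous for each s, and on a neighborhood of each threshold (1+s²) sup_{x in the neighborhood} f(s,x) is integrable in s. Fix reconstruction values ŝ₁,…,ŝ_L ∈ ℝ and thresholds −∞ = t₀ < t₁ < … < t_{L−1} < t_L = ∞, and define MSE(t₁,…,t_{L−1}) = Σ_{ℓ=1}^{L} ∫_ℝ ∫_{t_{ℓ−1}}^{t_ℓ} (s − ŝ_ℓ)² f(s,x) dx ds. Then for each ℓ ∈ {1,…,L−1}, the partial derivative of MSE with respect to t_ℓ exists and equals ∫_ℝ f(s,t_ℓ) [(s − ŝ_ℓ)² − (s − ŝ_{ℓ+1})²] ds = ∫_ℝ f(s,t_ℓ)(ŝ_ℓ − ŝ_{ℓ+1})(ŝ_ℓ + ŝ_{ℓ+1} − 2s) ds. -/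
open MeasureTheory

/-- The quantization cell numbered `j ∈ {1,…,L}` determined by thresholds
`t 1 < … < t (L-1)` (with `t 0 = −∞` and `t L = +∞` understood): the interval
`(t (j−1), t j]`, unbounded below for `j = 1` and unbounded above for `j = L`. -/
def cell (L : ℕ) (t : ℕ → ℝ) (j : ℕ) : Set ℝ :=
  {x : ℝ | (1 < j → t (j - 1) < x) ∧ (j < L → x ≤ t j)}

/-- A measurable density that is integrable against `1 + s ^ 2` stays integrable in `s` after
weighting by `w s = O(1 + s ^ 2)` and integrating out `x` over a set. -/
theorem integrable_mul_setIntegral_of_le {f : ℝ → ℝ → ℝ}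
    (hf_meas : Measurable (Function.uncurry f))
    (hf_int : Integrable (fun p : ℝ × ℝ => (1 + p.1 ^ 2) * f p.1 p.2))
    {w : ℝ → ℝ} (hw : Measurable w) {C : ℝ} (hwC : ∀ s, |w s| ≤ C * (1 + s ^ 2)) (B : Set ℝ) :
    Integrable (fun s => w s * ∫ x in B, f s x) := by
  have h1 : Integrable (fun p : ℝ × ℝ => w p.1 * f p.1 p.2) := by
    refine (hf_int.const_mul C).mono
      ((hw.comp measurable_fst).mul hf_meas).aestronglyMeasurable (.of_forall fun p => ?_)
    have h2 := mul_le_mul_of_nonneg_right (hwC p.1) (abs_nonneg (f p.1 p.2))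
    simp only [Real.norm_eq_abs, abs_mul]
    refine h2.trans ?_
    rw [abs_of_nonneg (by positivity : (0 : ℝ) ≤ 1 + p.1 ^ 2), ← mul_assoc]
    gcongr
    exact le_abs_self C
  have h2 : Integrable (fun p : ℝ × ℝ => w p.1 * f p.1 p.2)
      (volume.prod (volume.restrict B)) := by
    have h3 := h1.integrableOn (s := Set.univ ×ˢ B)
    rwa [IntegrableOn, Measure.volume_eq_prod, ← Measure.prod_restrict,
      Measure.restrict_univ] at h3
  simpa only [integral_const_mul] using h2.integral_prod_left

theorem ae_integrable_of_integrable_one_add_sq_mul {f : ℝ → ℝ → ℝ}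
    (hf_int : Integrable (fun p : ℝ × ℝ => (1 + p.1 ^ 2) * f p.1 p.2)) :
    ∀ᵐ s, Integrable (f s) := by
  filter_upwards [hf_int.prod_right_ae] with s hs
  have h0 : (1 + s ^ 2 : ℝ) ≠ 0 := by positivity
  exact (integrable_const_mul_iff h0.isUnit _).1 hs

/-- Fundamental theorem of calculus for the upper cut-off of a set `A`. -/
theorem hasDerivAt_setIntegral_inter_Iic {g : ℝ → ℝ} (hg : Continuous g) (hgi : Integrable g)
    {A : Set ℝ} (hA : MeasurableSet A) {u : ℝ} (hu : A ∈ nhds u) :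
    HasDerivAt (fun v => ∫ x in A ∩ Set.Iic v, g x) (g u) u := by
  have hi : Integrable (A.indicator g) := hgi.indicator hA
  have heq : A.indicator g =ᶠ[nhds u] g := by
    filter_upwards [hu] with x hx using Set.indicator_of_mem hx g
  have hd : HasDerivAt (fun v => ∫ x in u..v, A.indicator g x) (g u) u := by
    have h := intervalIntegral.integral_hasDerivAt_right (a := u) (b := u)
      hi.intervalIntegrable hi.aestronglyMeasurable.stronglyMeasurableAtFilter
      (hg.continuousAt.congr heq.symm)
    rwa [heq.eq_of_nhds] at h
  refine (hd.const_add (∫ x in Set.Iic u, A.indicator g x)).congr_of_eventuallyEq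
    (.of_forall fun v => ?_)
  have h := intervalIntegral.integral_Iic_sub_Iic (hi.integrableOn (s := Set.Iic u))
    (hi.integrableOn (s := Set.Iic v))
  have h2 : ∫ x in A ∩ Set.Iic v, g x = ∫ x in Set.Iic v, A.indicator g x := by
    rw [setIntegral_indicator hA, Set.inter_comm]
  simp only [h2]
  linarith

theorem hasDerivAt_integral_mul_setIntegral_inter_Iic {f : ℝ → ℝ → ℝ}
    (hf_meas : Measurable (Function.uncurry f)) (hf_nonneg : ∀ s x, 0 ≤ f s x)
    (hf_int : Integrable (fun p : ℝ × ℝ => (1 + p.1 ^ 2) * f p.1 p.2))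
    (hcont : ∀ s, Continuous (f s))
    {w : ℝ → ℝ} (hw : Measurable w) {C : ℝ} (hwC : ∀ s, |w s| ≤ C * (1 + s ^ 2))
    {A : Set ℝ} (hA : MeasurableSet A) {a ε : ℝ} (hε : 0 < ε) (hAa : A ∈ nhds a) {M : ℝ → ℝ}
    (hM : Integrable (fun s => (1 + s ^ 2) * M s))
    (hfM : ∀ s x, |x - a| < ε → f s x ≤ M s) :
    Integrable (fun s => w s * f s a) ∧
    HasDerivAt (fun u => ∫ s, w s * ∫ x in A ∩ Set.Iic u, f s x) (∫ s, w s * f s a) a := by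
  have hae := ae_integrable_of_integrable_one_add_sq_mul hf_int
  have hFi (u : ℝ) := integrable_mul_setIntegral_of_le hf_meas hf_int hw hwC
    (A ∩ Set.Iic u)
  have hnhds : Metric.ball a ε ∩ interior A ∈ nhds a :=
    Filter.inter_mem (Metric.ball_mem_nhds a hε) (interior_mem_nhds.2 hAa)
  refine hasDerivAt_integral_of_dominated_loc_of_deriv_le
    (F' := fun u s => w s * f s u) (bound := fun s => C * ((1 + s ^ 2) * M s)) hnhds
    (.of_forall fun u => (hFi u).aestronglyMeasurable) (hFi a) ?_ ?_ (hM.const_mul C) ?_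
  · exact (hw.mul (hf_meas.comp (measurable_id.prodMk measurable_const))).aestronglyMeasurable
  · refine .of_forall fun s u hu => ?_
    have h1 := hfM s u (by simpa [Real.dist_eq] using hu.1)
    rw [Real.norm_eq_abs, abs_mul, abs_of_nonneg (hf_nonneg s u), ← mul_assoc]
    exact mul_le_mul (hwC s) h1 (hf_nonneg s u) ((abs_nonneg _).trans (hwC s))
  · filter_upwards [hae] with s hs u hu
    exact (hasDerivAt_setIntegral_inter_Iic (hcont s) hs hA
      (mem_interior_iff_mem_nhds.1 hu.2)).const_mul (w s)

theorem hasDerivAt_integral_mul_setIntegral_inter_Ioi {f : ℝ → ℝ → ℝ}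
    (hf_meas : Measurable (Function.uncurry f)) (hf_nonneg : ∀ s x, 0 ≤ f s x)
    (hf_int : Integrable (fun p : ℝ × ℝ => (1 + p.1 ^ 2) * f p.1 p.2))
    (hcont : ∀ s, Continuous (f s))
    {w : ℝ → ℝ} (hw : Measurable w) {C : ℝ} (hwC : ∀ s, |w s| ≤ C * (1 + s ^ 2))
    {A : Set ℝ} (hA : MeasurableSet A) {a ε : ℝ} (hε : 0 < ε) (hAa : A ∈ nhds a) {M : ℝ → ℝ}
    (hM : Integrable (fun s => (1 + s ^ 2) * M s))
    (hfM : ∀ s x, |x - a| < ε → f s x ≤ M s) :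
    HasDerivAt (fun u => ∫ s, w s * ∫ x in A ∩ Set.Ioi u, f s x) (-∫ s, w s * f s a) a := by
  refine ((hasDerivAt_integral_mul_setIntegral_inter_Iic hf_meas hf_nonneg hf_int hcont hw hwC
    hA hε hAa hM hfM).2.const_sub (∫ s, w s * ∫ x in A, f s x)).congr_of_eventuallyEq
    (.of_forall fun u => ?_)
  dsimp only
  rw [← integral_sub (integrable_mul_setIntegral_of_le hf_meas hf_int hw hwC A)
    (integrable_mul_setIntegral_of_le hf_meas hf_int hw hwC (A ∩ Set.Iic u))]
  refine integral_congr_ae ?_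
  filter_upwards [ae_integrable_of_integrable_one_add_sq_mul hf_int] with s hs
  have h := integral_inter_add_sdiff (s := A) (measurableSet_Iic (a := u)) hs.integrableOn
  rw [Set.sdiff_eq, Set.compl_Iic] at h
  rw [← h]
  ring

theorem sq_sub_le_mul_one_add_sq (s c : ℝ) : |(s - c) ^ 2| ≤ 2 * (1 + c ^ 2) * (1 + s ^ 2) := by
  rw [abs_of_nonneg (sq_nonneg _)]
  nlinarith [sq_nonneg (s + c), mul_nonneg (sq_nonneg s) (sq_nonneg c)]

theorem cell_update_of_ne (L : ℕ) (t : ℕ → ℝ) {ℓ j : ℕ} (u : ℝ) (h : j ≠ ℓ) (h' : j - 1 ≠ ℓ) :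
    cell L (Function.update t ℓ u) j = cell L t j := by
  simp [cell, Function.update_of_ne h, Function.update_of_ne h']

theorem cell_update_self {L : ℕ} (t : ℕ → ℝ) {ℓ : ℕ} (u : ℝ) (h1 : 1 ≤ ℓ) (h : ℓ < L) :
    cell L (Function.update t ℓ u) ℓ = {x | 1 < ℓ → t (ℓ - 1) < x} ∩ Set.Iic u := by
  have h' : ℓ - 1 ≠ ℓ := by omega
  ext x
  simp [cell, Function.update_of_ne h', h]

theorem cell_update_succ (L : ℕ) (t : ℕ → ℝ) {ℓ : ℕ} (u : ℝ) (h1 : 1 ≤ ℓ) :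
    cell L (Function.update t ℓ u) (ℓ + 1) = {x | ℓ + 1 < L → x ≤ t (ℓ + 1)} ∩ Set.Ioi u := by
  ext x
  simp [cell, Nat.lt_iff_add_one_le.2 h1, and_comm]

/-- **derivative of the MSE with respect to a threshold, scalar case.**
Let `f` be a nonnegative measurable joint density of `(S, X)` such that `(1+s²)f(s,x)` is
integrable, `x ↦ f(s,x)` is continuous for each `s`, and `f` is locally dominated near each
threshold by a function `M(s)` with `(1+s²)M(s)` integrable.  Fix reconstruction values
`ŝ₁,…,ŝ_L` and thresholds `−∞ = t₀ < t₁ < … < t_{L−1} < t_L = ∞` and let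
`MSE(t₁,…,t_{L−1}) = Σ_{ℓ=1}^{L} ∫_ℝ ∫_{t_{ℓ−1}}^{t_ℓ} (s − ŝ_ℓ)² f(s,x) dx ds`.
Then for each `ℓ ∈ {1,…,L−1}`, the partial derivative of the MSE with respect to `t_ℓ` exists
and equals `∫_ℝ f(s,t_ℓ)[(s − ŝ_ℓ)² − (s − ŝ_{ℓ+1})²] ds
= ∫_ℝ f(s,t_ℓ)(ŝ_ℓ − ŝ_{ℓ+1})(ŝ_ℓ + ŝ_{ℓ+1} − 2s) ds`. -/
theorem stmt_8 (L : ℕ) (hL : 2 ≤ L) (f : ℝ → ℝ → ℝ)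
    (hf_meas : Measurable (Function.uncurry f))
    (hf_nonneg : ∀ s x, 0 ≤ f s x)
    (hf_int : Integrable (fun p : ℝ × ℝ => (1 + p.1 ^ 2) * f p.1 p.2))
    (shat : ℕ → ℝ) (t : ℕ → ℝ)
    (ht : ∀ i j : ℕ, 1 ≤ i → i < j → j ≤ L - 1 → t i < t j)
    (hcont : ∀ s, Continuous (f s))
    (hdom : ∀ j : ℕ, 1 ≤ j → j ≤ L - 1 → ∃ ε > (0 : ℝ), ∃ M : ℝ → ℝ,
      Integrable (fun s => (1 + s ^ 2) * M s) ∧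
      ∀ s x, |x - t j| < ε → f s x ≤ M s)
    (ℓ : ℕ) (hℓ1 : 1 ≤ ℓ) (hℓ2 : ℓ ≤ L - 1) :
    HasDerivAt
      (fun u => ∑ j ∈ Finset.Icc 1 L,
        ∫ s, (s - shat j) ^ 2 * ∫ x in cell L (Function.update t ℓ u) j, f s x)
      (∫ s, f s (t ℓ) * ((s - shat ℓ) ^ 2 - (s - shat (ℓ + 1)) ^ 2)) (t ℓ)
    ∧ (∫ s, f s (t ℓ) * ((s - shat ℓ) ^ 2 - (s - shat (ℓ + 1)) ^ 2))
        = ∫ s, f s (t ℓ) * (shat ℓ - shat (ℓ + 1)) * (shat ℓ + shat (ℓ + 1) - 2 * s) := by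
  obtain ⟨ε, hε, M, hM, hfM⟩ := hdom ℓ hℓ1 hℓ2
  have hw (c : ℝ) : Measurable (fun s : ℝ => (s - c) ^ 2) := by fun_prop
  have hwC (c s : ℝ) := sq_sub_le_mul_one_add_sq s c
  have hA : MeasurableSet {x | 1 < ℓ → t (ℓ - 1) < x} :=
    (MeasurableSet.const _).imp measurableSet_Ioi
  have hA' : MeasurableSet {x | ℓ + 1 < L → x ≤ t (ℓ + 1)} :=
    (MeasurableSet.const _).imp measurableSet_Iic
  have hAn : {x | 1 < ℓ → t (ℓ - 1) < x} ∈ nhds (t ℓ) := by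
    by_cases h : 1 < ℓ
    · filter_upwards [lt_mem_nhds (ht (ℓ - 1) ℓ (by omega) (by omega) hℓ2)] with x hx _ using hx
    · exact Filter.univ_mem' fun x hx => absurd hx h
  have hAn' : {x | ℓ + 1 < L → x ≤ t (ℓ + 1)} ∈ nhds (t ℓ) := by
    by_cases h : ℓ + 1 < L
    · filter_upwards [gt_mem_nhds (ht ℓ (ℓ + 1) hℓ1 (by omega) (by omega))] with x hx _ using hx.le
    · exact Filter.univ_mem' fun x hx => absurd hx h
  obtain ⟨hi, hd⟩ := hasDerivAt_integral_mul_setIntegral_inter_Iic hf_meas hf_nonneg hf_int hcont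
    (hw (shat ℓ)) (hwC (shat ℓ)) hA hε hAn hM hfM
  have hi' := (hasDerivAt_integral_mul_setIntegral_inter_Iic hf_meas hf_nonneg hf_int hcont
    (hw (shat (ℓ + 1))) (hwC (shat (ℓ + 1))) hA' hε hAn' hM hfM).1
  have hd' := hasDerivAt_integral_mul_setIntegral_inter_Ioi hf_meas hf_nonneg hf_int hcont
    (hw (shat (ℓ + 1))) (hwC (shat (ℓ + 1))) hA' hε hAn' hM hfM
  refine ⟨?_, integral_congr_ae (.of_forall fun s => by ring)⟩
  have hval : (∫ s, f s (t ℓ) * ((s - shat ℓ) ^ 2 - (s - shat (ℓ + 1)) ^ 2)) =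
      (∫ s, (s - shat ℓ) ^ 2 * f s (t ℓ)) + -∫ s, (s - shat (ℓ + 1)) ^ 2 * f s (t ℓ) := by
    rw [← sub_eq_add_neg, ← integral_sub hi hi']
    exact integral_congr_ae (.of_forall fun s => by ring)
  rw [hval]
  refine ((hd.add hd').add_const (∑ j ∈ ((Finset.Icc 1 L).erase ℓ).erase (ℓ + 1),
    ∫ s, (s - shat j) ^ 2 * ∫ x in cell L t j, f s x)).congr_of_eventuallyEq
    (.of_forall fun u => ?_)
  have hm : ℓ ∈ Finset.Icc 1 L := Finset.mem_Icc.2 ⟨hℓ1, by omega⟩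
  have hm' : ℓ + 1 ∈ (Finset.Icc 1 L).erase ℓ :=
    Finset.mem_erase.2 ⟨by omega, Finset.mem_Icc.2 ⟨by omega, by omega⟩⟩
  dsimp only [Pi.add_apply]
  rw [← Finset.add_sum_erase _ _ hm, ← Finset.add_sum_erase _ _ hm',
    cell_update_self t u hℓ1 (by omega), cell_update_succ L t u hℓ1, add_assoc]
  congr 2
  refine Finset.sum_congr rfl fun j hj => ?_
  simp only [Finset.mem_erase, Finset.mem_Icc] at hj
  rw [cell_update_of_ne L t u (by omega) (by omega)]
end

section
/- (Appendix identity: derivative of the two-dimensional MSE with respect to a shared threshold.) Let f : ℝ × ℝ² → ℝ be a nonnegative measurable joint density of (S, X₁, X₂), with (s,x₁,x₂) ↦ (1+s²)f(s,x₁,x₂) integrable, continuous in (x₁,x₂) for each s, and locally dominated near each threshold by integrable functions of the remaining variables. Fix thresholds −∞ = t₀ < t₁ < … < t_{T} < t_{T+1} = ∞ applied identically in both coordinates, and reconstruction values ŝ_{i₁,i₂} ∈ ℝ for i₁,i₂ ∈ {1,…,T+1}. Define MSE = Σ_{i₁,i₂} ∫_ℝ (s − ŝ_{i₁,i₂})²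 ∫_{t_{i₁−1}}^{t_{i₁}} ∫_{t_{i₂−1}}^{t_{i₂}} f(s,x₁,x₂) dx₂ dx₁ ds. Then for each ℓ ∈ {1,…,T}, ∂MSE/∂t_ℓ = Σ_{i₁=1}^{T+1} ∫_ℝ [(s − ŝ_{i₁,ℓ})² − (s − ŝ_{i₁,ℓ+1})²] ∫_{t_{i₁−1}}^{t_{i₁}} f(s, x₁, t_ℓ) dx₁ ds + Σ_{i₂=1}^{T+1} ∫_ℝ [(s − ŝ_{ℓ,i₂})² − (s − ŝ_{ℓ+1,i₂})²] ∫_{t_{i₂−1}}^{t_{i₂}} f(s, t_ℓ, x₂) dx₂ ds. -/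
open MeasureTheory

open Set Filter Topology

/-- The integral of `w(s) a(x) b(y) f(s,x,y)` over `ℝ³`. -/
noncomputable def weightedIntegral (f : ℝ → ℝ → ℝ → ℝ) (w a b : ℝ → ℝ) : ℝ :=
  ∫ p : ℝ × ℝ × ℝ, a p.2.1 * b p.2.2 * (w p.1 * f p.1 p.2.1 p.2.2)

/-- The signed indicator of the oriented interval from `t` to `u`. -/
noncomputable def orientedIndicator (t u x : ℝ) : ℝ :=
  (if t ≤ u then 1 else -1) * (uIoc t u).indicator (fun _ => (1 : ℝ)) x

lemma measurable_orientedIndicator (t u : ℝ) : Measurable (orientedIndicator t u) :=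
  (measurable_const.indicator measurableSet_uIoc).const_mul _

lemma abs_orientedIndicator_le_one (t u x : ℝ) : |orientedIndicator t u x| ≤ 1 := by
  unfold orientedIndicator indicator
  split_ifs <;> norm_num

lemma integral_orientedIndicator_mul (t u : ℝ) (g : ℝ → ℝ) :
    ∫ x, orientedIndicator t u x * g x = ∫ x in t..u, g x := by
  rw [intervalIntegral.intervalIntegral_eq_integral_uIoc, ← integral_indicator measurableSet_uIoc,
    smul_eq_mul, ← integral_const_mul]
  refine integral_congr_ae (.of_forall fun x => ?_)
  simp only [orientedIndicator, indicator]
  split_ifs <;> simp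

lemma tendsto_orientedIndicator {t x : ℝ} (hx : x ≠ t) :
    Tendsto (fun u => orientedIndicator t u x) (𝓝[≠] t) (𝓝 0) := by
  refine tendsto_nhdsWithin_of_tendsto_nhds (tendsto_const_nhds.congr' ?_)
  filter_upwards [Metric.ball_mem_nhds t (abs_pos.2 (sub_ne_zero.2 hx))] with u hu
  rw [Metric.mem_ball, Real.dist_eq] at hu
  have : x ∉ uIoc t u := by
    intro h
    have h' := abs_sub_left_of_mem_uIcc (uIoc_subset_uIcc h)
    linarith
  simp [orientedIndicator, this]

lemma integrable_mul_mul_of_abs_le_one {f : ℝ → ℝ → ℝ → ℝ} {w a b : ℝ → ℝ}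
    (hwf : Integrable fun p : ℝ × ℝ × ℝ => w p.1 * f p.1 p.2.1 p.2.2)
    (ha : Measurable a) (hb : Measurable b) (ha1 : ∀ x, |a x| ≤ 1) (hb1 : ∀ x, |b x| ≤ 1) :
    Integrable fun p : ℝ × ℝ × ℝ => a p.2.1 * b p.2.2 * (w p.1 * f p.1 p.2.1 p.2.2) := by
  refine hwf.bdd_mul (c := 1) (by fun_prop) (.of_forall fun p => ?_)
  rw [Real.norm_eq_abs, abs_mul]
  exact mul_le_one₀ (ha1 _) (abs_nonneg _) (hb1 _)

lemma weightedIntegral_swap (f : ℝ → ℝ → ℝ → ℝ) (w a b : ℝ → ℝ) :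
    weightedIntegral f w a b = weightedIntegral (fun s x y => f s y x) w b a := by
  have h : MeasurePreserving
      ((MeasurableEquiv.refl ℝ).prodCongr (MeasurableEquiv.prodComm (α := ℝ) (β := ℝ))) :=
    (MeasurePreserving.id volume).prod Measure.measurePreserving_swap
  unfold weightedIntegral
  rw [← h.integral_comp']
  refine integral_congr_ae (.of_forall fun p => ?_)
  change a p.2.2 * b p.2.1 * _ = b p.2.1 * a p.2.2 * _
  rw [mul_comm (a _)]
  rfl

lemma weightedIntegral_indicator {f : ℝ → ℝ → ℝ → ℝ} {w : ℝ → ℝ} {A B : Set ℝ}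
    (hwf : Integrable fun p : ℝ × ℝ × ℝ => w p.1 * f p.1 p.2.1 p.2.2)
    (hA : MeasurableSet A) (hB : MeasurableSet B) :
    weightedIntegral f w (A.indicator fun _ => 1) (B.indicator fun _ => 1) =
      ∫ s, w s * ∫ x in A, ∫ y in B, f s x y := by
  have hi := hwf.indicator (MeasurableSet.univ.prod (hA.prod hB))
  have heq : weightedIntegral f w (A.indicator fun _ => 1) (B.indicator fun _ => 1) =
      ∫ p : ℝ × ℝ × ℝ, (univ ×ˢ A ×ˢ B).indicator
        (fun p : ℝ × ℝ × ℝ => w p.1 * f p.1 p.2.1 p.2.2) p := by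
    refine integral_congr_ae (.of_forall fun p => ?_)
    by_cases h1 : p.2.1 ∈ A <;> by_cases h2 : p.2.2 ∈ B <;> simp [h1, h2, mem_prod]
  rw [heq, Measure.volume_eq_prod, integral_prod _ hi]
  refine integral_congr_ae ?_
  filter_upwards [hi.prod_right_ae] with s hs
  rw [Measure.volume_eq_prod, integral_prod _ hs, ← integral_const_mul,
    ← integral_indicator hA]
  refine integral_congr_ae (.of_forall fun x => ?_)
  by_cases hx : x ∈ A
  · simp only [indicator_of_mem hx]
    rw [← integral_const_mul, ← integral_indicator hB]
    refine integral_congr_ae (.of_forall fun y => ?_)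
    by_cases hy : y ∈ B <;> simp [hx, hy, mem_prod]
  · simp [hx, mem_prod]

lemma weightedIntegral_orientedIndicator {f : ℝ → ℝ → ℝ → ℝ} {w a : ℝ → ℝ} {t u : ℝ}
    (hwf : Integrable fun p : ℝ × ℝ × ℝ => w p.1 * f p.1 p.2.1 p.2.2)
    (ha : Measurable a) (ha1 : ∀ x, |a x| ≤ 1) :
    weightedIntegral f w a (orientedIndicator t u) =
      ∫ p : ℝ × ℝ, a p.2 * w p.1 * ∫ y in t..u, f p.1 p.2 y := by
  have hi := integrable_mul_mul_of_abs_le_one hwf ha (measurable_orientedIndicator t u) ha1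
    (abs_orientedIndicator_le_one t u)
  have hassoc : MeasurePreserving (MeasurableEquiv.prodAssoc (α := ℝ) (β := ℝ) (γ := ℝ)) :=
    measurePreserving_prodAssoc volume volume volume
  have hi' := (hassoc.integrable_comp_emb
    (MeasurableEquiv.prodAssoc (α := ℝ) (β := ℝ) (γ := ℝ)).measurableEmbedding).2 hi
  unfold weightedIntegral
  rw [← hassoc.integral_comp', Measure.volume_eq_prod]
  refine (integral_prod _ hi').trans (integral_congr_ae (.of_forall fun p => ?_))
  change ∫ y, a p.2 * orientedIndicator t u y * (w p.1 * f p.1 p.2 y) =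
    a p.2 * w p.1 * ∫ y in t..u, f p.1 p.2 y
  rw [← integral_orientedIndicator_mul, ← integral_const_mul]
  refine integral_congr_ae (.of_forall fun y => ?_)
  ring

lemma hasDerivAt_weightedIntegral {f : ℝ → ℝ → ℝ → ℝ} {w a : ℝ → ℝ} {b : ℝ → ℝ → ℝ}
    {M : ℝ → ℝ → ℝ} {t ε : ℝ}
    (hf : Measurable fun p : ℝ × ℝ × ℝ => f p.1 p.2.1 p.2.2)
    (hf0 : ∀ s x y, 0 ≤ f s x y) (hc : ∀ s x, Continuous (f s x)) (hw : Measurable w)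
    (hwf : Integrable fun p : ℝ × ℝ × ℝ => w p.1 * f p.1 p.2.1 p.2.2)
    (hM : Integrable fun p : ℝ × ℝ => w p.1 * M p.1 p.2) (hε : 0 < ε)
    (hdom : ∀ s x y, |y - t| < ε → f s x y ≤ M s x)
    (hb : ∀ u, Measurable (b u)) (hb1 : ∀ u x, |b u x| ≤ 1)
    (hlim : ∀ x, x ≠ t → Tendsto (fun u => b u x) (𝓝[≠] t) (𝓝 (a x))) :
    HasDerivAt (fun u => weightedIntegral f w (b u) (orientedIndicator t u))
      (∫ p : ℝ × ℝ, a p.2 * w p.1 * f p.1 p.2 t) t := by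
  rw [hasDerivAt_iff_tendsto_slope]
  have hslope : slope (fun u => weightedIntegral f w (b u) (orientedIndicator t u)) t =
      fun u => ∫ p : ℝ × ℝ, b u p.2 * w p.1 * slope (fun v => ∫ y in t..v, f p.1 p.2 y) t u := by
    funext u
    simp only [slope_def_module, weightedIntegral_orientedIndicator hwf (hb _) (hb1 _),
      intervalIntegral.integral_same, mul_zero, integral_zero, sub_zero, smul_eq_mul]
    rw [← integral_const_mul]
    refine integral_congr_ae (.of_forall fun p => ?_)
    ring
  rw [hslope]
  refine tendsto_integral_filter_of_dominated_convergence
    (fun p : ℝ × ℝ => ‖w p.1 * M p.1 p.2‖) (.of_forall fun u => ?_) ?_ hM.norm ?_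
  · have hm : StronglyMeasurable fun p : ℝ × ℝ => ∫ y in t..u, f p.1 p.2 y := by
      have hf' : StronglyMeasurable
          (Function.uncurry fun (p : ℝ × ℝ) (y : ℝ) => f p.1 p.2 y) :=
        (hf.comp (by fun_prop : Measurable fun q : (ℝ × ℝ) × ℝ =>
          (q.1.1, q.1.2, q.2))).stronglyMeasurable
      exact hf'.integral_prod_right.sub hf'.integral_prod_right
    have hbu := hb u
    simp only [slope_def_module, intervalIntegral.integral_same, sub_zero, smul_eq_mul]
    have := hm.measurable
    exact Measurable.aestronglyMeasurable (by fun_prop)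
  · filter_upwards [nhdsWithin_le_nhds (Metric.ball_mem_nhds t hε), self_mem_nhdsWithin]
      with u hu hne
    rw [Metric.mem_ball, Real.dist_eq] at hu
    refine .of_forall fun p => ?_
    have hpos : 0 < |u - t| := abs_pos.2 (sub_ne_zero.2 hne)
    have hle : ‖∫ y in t..u, f p.1 p.2 y‖ ≤ |M p.1 p.2| * |u - t| := by
      refine intervalIntegral.norm_integral_le_of_norm_le_const fun y hy => ?_
      rw [Real.norm_eq_abs, abs_of_nonneg (hf0 _ _ _)]
      refine (hdom _ _ _ ((abs_sub_left_of_mem_uIcc (uIoc_subset_uIcc hy)).trans_lt hu)).trans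
        (le_abs_self _)
    have hle' : ‖slope (fun v => ∫ y in t..v, f p.1 p.2 y) t u‖ ≤ |M p.1 p.2| := by
      rw [slope_def_field, intervalIntegral.integral_same, sub_zero, norm_div,
        Real.norm_eq_abs (u - t), div_le_iff₀ hpos]
      exact hle
    rw [norm_mul, norm_mul, norm_mul, Real.norm_eq_abs (M _ _)]
    refine mul_le_mul ?_ hle' (norm_nonneg _) (norm_nonneg _)
    exact mul_le_of_le_one_left (norm_nonneg _) (hb1 _ _)
  · have hae : ∀ᵐ p : ℝ × ℝ, p.2 ≠ t :=
      Measure.quasiMeasurePreserving_snd.ae (p := fun x => x ≠ t) (Measure.ae_ne volume t)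
    filter_upwards [hae] with p hp
    refine ((hlim _ hp).mul_const _).mul ?_
    exact hasDerivAt_iff_tendsto_slope.1
      (intervalIntegral.integral_hasDerivAt_right (by simp)
        ((hc _ _).stronglyMeasurableAtFilter _ _) (hc _ _).continuousAt)

lemma integrable_mul_of_dominated {g M : ℝ → ℝ → ℝ} {w : ℝ → ℝ}
    (hg : Measurable fun p : ℝ × ℝ => g p.1 p.2) (hg0 : ∀ s x, 0 ≤ g s x)
    (hw : Measurable w) (hM : Integrable fun p : ℝ × ℝ => w p.1 * M p.1 p.2)
    (hdom : ∀ s x, g s x ≤ M s x) :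
    Integrable fun p : ℝ × ℝ => w p.1 * g p.1 p.2 := by
  refine hM.mono (by fun_prop) (.of_forall fun p => ?_)
  rw [norm_mul, norm_mul]
  refine mul_le_mul_of_nonneg_left ?_ (norm_nonneg _)
  exact abs_le_abs_of_nonneg (hg0 _ _) (hdom _ _)

lemma indicator_mul_eq_indicator_prod {g : ℝ → ℝ → ℝ} {w : ℝ → ℝ} (A : Set ℝ) :
    (fun p : ℝ × ℝ => A.indicator (fun _ => 1) p.2 * w p.1 * g p.1 p.2) =
      (univ ×ˢ A).indicator fun p : ℝ × ℝ => w p.1 * g p.1 p.2 := by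
  funext p
  by_cases hp : p.2 ∈ A <;> simp [hp, mem_prod]

lemma integral_indicator_mul_eq_mul_setIntegral (g : ℝ → ℝ → ℝ) (w : ℝ → ℝ) {A : Set ℝ}
    (hA : MeasurableSet A) (s : ℝ) :
    ∫ x, (univ ×ˢ A).indicator (fun p : ℝ × ℝ => w p.1 * g p.1 p.2) (s, x) =
      w s * ∫ x in A, g s x := by
  rw [← integral_const_mul, ← integral_indicator hA]
  refine integral_congr_ae (.of_forall fun x => ?_)
  by_cases hx : x ∈ A <;> simp [hx, mem_prod]

lemma integral_indicator_mul {g : ℝ → ℝ → ℝ} {w : ℝ → ℝ} {A : Set ℝ} (hA : MeasurableSet A)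
    (hi : Integrable fun p : ℝ × ℝ => w p.1 * g p.1 p.2) :
    ∫ p : ℝ × ℝ, A.indicator (fun _ => 1) p.2 * w p.1 * g p.1 p.2 =
      ∫ s, w s * ∫ x in A, g s x := by
  rw [indicator_mul_eq_indicator_prod, Measure.volume_eq_prod,
    integral_prod _ (hi.indicator (MeasurableSet.univ.prod hA))]
  simp_rw [integral_indicator_mul_eq_mul_setIntegral g w hA]

lemma integrable_mul_setIntegral {g : ℝ → ℝ → ℝ} {w : ℝ → ℝ} {A : Set ℝ} (hA : MeasurableSet A)
    (hi : Integrable fun p : ℝ × ℝ => w p.1 * g p.1 p.2) :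
    Integrable fun s => w s * ∫ x in A, g s x := by
  have h := (hi.indicator (MeasurableSet.univ.prod hA)).integral_prod_left
  simp_rw [integral_indicator_mul_eq_mul_setIntegral g w hA] at h
  exact h

lemma measurableSet_cell (L : ℕ) (t : ℕ → ℝ) (j : ℕ) : MeasurableSet (cell L t j) := by
  refine MeasurableSet.inter (s₁ := {x | 1 < j → t (j - 1) < x}) (s₂ := {x | j < L → x ≤ t j}) ?_ ?_
  · exact (MeasurableSet.const _).imp measurableSet_Ioi
  · exact (MeasurableSet.const _).imp measurableSet_Iic

lemma abs_indicator_one_le_one (A : Set ℝ) (x : ℝ) : |A.indicator (fun _ => (1 : ℝ)) x| ≤ 1 := by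
  unfold indicator
  split_ifs <;> norm_num

/-- The rate at which the indicator of cell `i` changes when threshold `ℓ` moves to the right. -/
def cellSign (ℓ i : ℕ) : ℝ := (if i = ℓ then 1 else 0) - (if i = ℓ + 1 then 1 else 0)

lemma eventually_indicator_cell_update {T ℓ i : ℕ} {t : ℕ → ℝ}
    (ht : ∀ i j : ℕ, 1 ≤ i → i < j → j ≤ T → t i < t j) (hℓ1 : 1 ≤ ℓ) (hℓ2 : ℓ ≤ T)
    (hi : 1 ≤ i) :
    ∀ᶠ u in 𝓝 (t ℓ), ∀ x,
      (cell (T + 1) (Function.update t ℓ u) i).indicator (fun _ => (1 : ℝ)) x =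
        (cell (T + 1) t i).indicator (fun _ => 1) x
          + cellSign ℓ i * orientedIndicator (t ℓ) u x := by
  have hlow : ∀ᶠ u in 𝓝 (t ℓ), 1 < ℓ → t (ℓ - 1) < u := by
    by_cases h : 1 < ℓ
    · filter_upwards [lt_mem_nhds (ht (ℓ - 1) ℓ (by omega) (by omega) hℓ2)] with u hu _ using hu
    · exact .of_forall fun u h' => absurd h' h
  have hupp : ∀ᶠ u in 𝓝 (t ℓ), ℓ + 1 < T + 1 → u < t (ℓ + 1) := by
    by_cases h : ℓ + 1 < T + 1
    · filter_upwards [gt_mem_nhds (ht ℓ (ℓ + 1) hℓ1 (by omega) (by omega))] with u hu _ using hu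
    · exact .of_forall fun u h' => absurd h' h
  filter_upwards [hlow, hupp] with u hu1 hu2 x
  have hl : 1 < ℓ → t (ℓ - 1) < t ℓ := fun h => ht _ _ (by omega) (by omega) hℓ2
  have hr : ℓ + 1 < T + 1 → t ℓ < t (ℓ + 1) := fun h => ht _ _ hℓ1 (by omega) (by omega)
  have hlT : ℓ < T + 1 := by omega
  have h0 : ℓ - 1 ≠ ℓ := by omega
  have h1 : ℓ + 1 ≠ ℓ := by omega
  have h2 : 1 < ℓ + 1 := by omega
  simp only [orientedIndicator, indicator, cellSign, mem_uIoc, cell, mem_ofPred_eq]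
  rcases eq_or_ne i ℓ with rfl | hne
  · simp only [Function.update_self, Function.update_of_ne h0, hlT, forall_true_left]
    rcases le_total (t i) u with h | h <;> grind
  · rcases eq_or_ne i (ℓ + 1) with rfl | hne'
    · simp only [Nat.add_sub_cancel, Function.update_self, Function.update_of_ne h1, h2,
        forall_true_left]
      rcases le_total (t ℓ) u with h | h <;> grind
    · have h3 : i - 1 ≠ ℓ := by omega
      simp [Function.update_of_ne h3, hne, hne']

/-- Derivative, with respect to the threshold `ℓ`, of the contribution of a single product cell. -/
lemma hasDerivAt_integral_cell {T ℓ i j : ℕ} {t : ℕ → ℝ} {f : ℝ → ℝ → ℝ → ℝ} {w : ℝ → ℝ}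
    {M : ℝ → ℝ → ℝ} {ε : ℝ}
    (ht : ∀ i j : ℕ, 1 ≤ i → i < j → j ≤ T → t i < t j) (hℓ1 : 1 ≤ ℓ) (hℓ2 : ℓ ≤ T)
    (hi : 1 ≤ i) (hj : 1 ≤ j)
    (hf : Measurable fun p : ℝ × ℝ × ℝ => f p.1 p.2.1 p.2.2)
    (hf0 : ∀ s x y, 0 ≤ f s x y) (hc : ∀ s, Continuous fun p : ℝ × ℝ => f s p.1 p.2)
    (hw : Measurable w)
    (hwf : Integrable fun p : ℝ × ℝ × ℝ => w p.1 * f p.1 p.2.1 p.2.2)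
    (hM : Integrable fun p : ℝ × ℝ => w p.1 * M p.1 p.2) (hε : 0 < ε)
    (hdom : ∀ s x y, |y - t ℓ| < ε → f s x y ≤ M s x ∧ f s y x ≤ M s x) :
    HasDerivAt
      (fun u => ∫ s, w s * ∫ x in cell (T + 1) (Function.update t ℓ u) i,
        ∫ y in cell (T + 1) (Function.update t ℓ u) j, f s x y)
      (cellSign ℓ j * (∫ s, w s * ∫ x in cell (T + 1) t i, f s x (t ℓ))
        + cellSign ℓ i * ∫ s, w s * ∫ y in cell (T + 1) t j, f s (t ℓ) y)
      (t ℓ) := by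
  have hf' : Measurable fun p : ℝ × ℝ × ℝ => f p.1 p.2.2 p.2.1 :=
    hf.comp (by fun_prop : Measurable fun p : ℝ × ℝ × ℝ => (p.1, p.2.2, p.2.1))
  have hwf' : Integrable fun p : ℝ × ℝ × ℝ => w p.1 * f p.1 p.2.2 p.2.1 :=
    ((MeasurePreserving.id (volume : Measure ℝ)).prod
      (Measure.measurePreserving_swap (μ := (volume : Measure ℝ))
        (ν := (volume : Measure ℝ)))).integrable_comp_of_integrable hwf
  have hnear : |t ℓ - t ℓ| < ε := by simpa using hε
  have hright : Integrable fun p : ℝ × ℝ => w p.1 * f p.1 p.2 (t ℓ) :=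
    integrable_mul_of_dominated (g := fun s x => f s x (t ℓ))
      (hf.comp (by fun_prop : Measurable fun p : ℝ × ℝ => (p.1, p.2, t ℓ)))
      (fun _ _ => hf0 _ _ _) hw hM fun s x => (hdom s x _ hnear).1
  have hleft : Integrable fun p : ℝ × ℝ => w p.1 * f p.1 (t ℓ) p.2 :=
    integrable_mul_of_dominated (g := fun s x => f s (t ℓ) x)
      (hf.comp (by fun_prop : Measurable fun p : ℝ × ℝ => (p.1, t ℓ, p.2)))
      (fun _ _ => hf0 _ _ _) hw hM fun s x => (hdom s x _ hnear).2
  have hev := fun {k : ℕ} => eventually_indicator_cell_update (i := k) ht hℓ1 hℓ2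
  let χ : ℕ → ℝ → ℝ → ℝ := fun k u =>
    (cell (T + 1) (Function.update t ℓ u) k).indicator fun _ => 1
  have hχ : ∀ k u, Measurable (χ k u) := fun k u =>
    measurable_const.indicator (measurableSet_cell _ _ _)
  have hχ1 : ∀ k u x, |χ k u x| ≤ 1 := fun k u => abs_indicator_one_le_one _
  have hχt : ∀ k, χ k (t ℓ) = (cell (T + 1) t k).indicator fun _ => 1 := fun k => by
    simp [χ]
  have hlim : ∀ x, x ≠ t ℓ → Tendsto (fun u => χ j u x) (𝓝[≠] (t ℓ))
      (𝓝 ((cell (T + 1) t j).indicator (fun _ => 1) x)) := fun x hx => by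
    have h := ((tendsto_orientedIndicator hx).const_mul (cellSign ℓ j)).const_add
      ((cell (T + 1) t j).indicator (fun _ => (1 : ℝ)) x)
    rw [mul_zero, add_zero] at h
    refine h.congr' ?_
    filter_upwards [nhdsWithin_le_nhds (hev hj)] with u hu using (hu x).symm
  have hD1 := hasDerivAt_weightedIntegral (b := fun _ => χ i (t ℓ)) hf hf0
    (fun s x => (hc s).comp (by fun_prop : Continuous fun y : ℝ => (x, y))) hw hwf hM hε
    (fun s x y h => (hdom s x y h).1) (fun _ => hχ _ _) (fun _ => hχ1 _ _)
    (fun _ _ => tendsto_const_nhds)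
  have hD2 := hasDerivAt_weightedIntegral (f := fun s x y => f s y x) (b := χ j) hf'
    (fun _ _ _ => hf0 _ _ _)
    (fun s x => (hc s).comp (by fun_prop : Continuous fun y : ℝ => (y, x))) hw hwf' hM hε
    (fun s x y h => (hdom s x y h).2) (hχ _) (hχ1 _) hlim
  rw [hχt, integral_indicator_mul (g := fun s x => f s x (t ℓ)) (measurableSet_cell _ _ _) hright]
    at hD1
  rw [integral_indicator_mul (g := fun s x => f s (t ℓ) x) (measurableSet_cell _ _ _) hleft] at hD2
  refine (((hD1.const_mul (cellSign ℓ j)).add (hD2.const_mul (cellSign ℓ i))).const_add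
    (weightedIntegral f w (χ i (t ℓ)) (χ j (t ℓ)))).congr_of_eventuallyEq ?_
  filter_upwards [hev hi, hev hj] with u hui huj
  have hwf3 : ∀ {a b : ℝ → ℝ}, Measurable a → Measurable b → (∀ x, |a x| ≤ 1) →
      (∀ x, |b x| ≤ 1) →
      Integrable fun p : ℝ × ℝ × ℝ => a p.2.1 * b p.2.2 * (w p.1 * f p.1 p.2.1 p.2.2) :=
    integrable_mul_mul_of_abs_le_one hwf
  have hδ := measurable_orientedIndicator (t ℓ) u
  have hδ1 := abs_orientedIndicator_le_one (t ℓ) u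
  simp only [Pi.add_apply]
  rw [← weightedIntegral_indicator hwf (measurableSet_cell _ _ _) (measurableSet_cell _ _ _),
    ← weightedIntegral_swap f w, ← hχt]
  unfold weightedIntegral
  rw [← integral_const_mul, ← integral_const_mul, ← integral_add, ← integral_add]
  · refine integral_congr_ae (.of_forall fun p => ?_)
    change χ i u p.2.1 * χ j u p.2.2 * _ = _
    have h1 : χ i u p.2.1 = χ i (t ℓ) p.2.1 + _ := (hui p.2.1).trans (by rw [hχt])
    have h2 : χ j u p.2.2 = χ j (t ℓ) p.2.2 + _ := (huj p.2.2).trans (by rw [hχt])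
    simp only [h1, h2]
    ring
  · exact hwf3 (hχ _ _) (hχ _ _) (hχ1 _ _) (hχ1 _ _)
  · exact ((hwf3 (hχ _ _) hδ (hχ1 _ _) hδ1).const_mul _).add
      ((hwf3 hδ (hχ _ _) hδ1 (hχ1 _ _)).const_mul _)
  · exact (hwf3 (hχ _ _) hδ (hχ1 _ _) hδ1).const_mul _
  · exact (hwf3 hδ (hχ _ _) hδ1 (hχ1 _ _)).const_mul _

lemma sum_cellSign_mul {T ℓ : ℕ} (hℓ1 : 1 ≤ ℓ) (hℓ2 : ℓ ≤ T) (E : ℕ → ℝ) :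
    ∑ i ∈ Finset.Icc 1 (T + 1), cellSign ℓ i * E i = E ℓ - E (ℓ + 1) := by
  simp only [cellSign, sub_mul, ite_mul, one_mul, zero_mul, Finset.sum_sub_distrib,
    Finset.sum_ite_eq', Finset.mem_Icc]
  rw [if_pos (by omega), if_pos (by omega)]

lemma integrable_sub_sq_mul {α : Type*} [MeasurableSpace α] {μ : Measure α} {σ g : α → ℝ}
    (hσ : AEStronglyMeasurable σ μ) (hg : Integrable (fun p => (1 + σ p ^ 2) * g p) μ) (c : ℝ) :
    Integrable (fun p => (σ p - c) ^ 2 * g p) μ := by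
  have hpos : ∀ p, 0 < 1 + σ p ^ 2 := fun p => by positivity
  have h : (fun p => (σ p - c) ^ 2 * g p) =
      fun p => (σ p - c) ^ 2 / (1 + σ p ^ 2) * ((1 + σ p ^ 2) * g p) := by
    funext p
    have := (hpos p).ne'
    field_simp
  rw [h]
  have hm : AEMeasurable σ μ := hσ.aemeasurable
  refine hg.bdd_mul (c := 2 * (1 + c ^ 2))
    (by fun_prop : AEMeasurable _ μ).aestronglyMeasurable (.of_forall fun p => ?_)
  rw [Real.norm_of_nonneg (by positivity), div_le_iff₀ (hpos p)]
  nlinarith [sq_nonneg (σ p + c), sq_nonneg (σ p * c)]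

/-- **Appendix identity: derivative of the two-dimensional MSE with respect to a
shared threshold.**  Let `f` be a nonnegative measurable joint density of `(S, X₁, X₂)` with
`(1+s²)f` integrable, continuous in `(x₁,x₂)` for each `s`, and locally dominated near each
threshold by integrable functions of the remaining variables.  Fix thresholds
`−∞ = t₀ < t₁ < … < t_T < t_{T+1} = ∞` applied identically in both coordinates and
reconstruction values `ŝ_{i₁,i₂}`, and let
`MSE = Σ_{i₁,i₂} ∫_ℝ (s − ŝ_{i₁,i₂})² ∫∫_{cell i₁ × cell i₂} f dx₂ dx₁ ds`.  Then for each
`ℓ ∈ {1,…,T}`, `∂MSE/∂t_ℓ` exists and equals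
`Σ_{i₁} ∫_ℝ [(s − ŝ_{i₁,ℓ})² − (s − ŝ_{i₁,ℓ+1})²] ∫_{cell i₁} f(s,x₁,t_ℓ) dx₁ ds
 + Σ_{i₂} ∫_ℝ [(s − ŝ_{ℓ,i₂})² − (s − ŝ_{ℓ+1,i₂})²] ∫_{cell i₂} f(s,t_ℓ,x₂) dx₂ ds`. -/
theorem stmt_13 (T : ℕ) (hT : 1 ≤ T) (f : ℝ → ℝ → ℝ → ℝ)
    (hf_meas : Measurable (fun p : ℝ × ℝ × ℝ => f p.1 p.2.1 p.2.2))
    (hf_nonneg : ∀ s x₁ x₂, 0 ≤ f s x₁ x₂)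
    (hf_int : Integrable (fun p : ℝ × ℝ × ℝ => (1 + p.1 ^ 2) * f p.1 p.2.1 p.2.2))
    (hcont : ∀ s, Continuous (fun p : ℝ × ℝ => f s p.1 p.2))
    (shat : ℕ → ℕ → ℝ) (t : ℕ → ℝ)
    (ht : ∀ i j : ℕ, 1 ≤ i → i < j → j ≤ T → t i < t j)
    (hdom : ∀ j : ℕ, 1 ≤ j → j ≤ T → ∃ ε > (0 : ℝ), ∃ M : ℝ → ℝ → ℝ,
      Integrable (fun p : ℝ × ℝ => (1 + p.1 ^ 2) * M p.1 p.2) ∧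
      ∀ s x y, |y - t j| < ε → f s x y ≤ M s x ∧ f s y x ≤ M s x)
    (ℓ : ℕ) (hℓ1 : 1 ≤ ℓ) (hℓ2 : ℓ ≤ T) :
    HasDerivAt
      (fun u => ∑ i₁ ∈ Finset.Icc 1 (T + 1), ∑ i₂ ∈ Finset.Icc 1 (T + 1),
        ∫ s, (s - shat i₁ i₂) ^ 2 *
          ∫ x₁ in cell (T + 1) (Function.update t ℓ u) i₁,
            ∫ x₂ in cell (T + 1) (Function.update t ℓ u) i₂, f s x₁ x₂)
      ((∑ i₁ ∈ Finset.Icc 1 (T + 1),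
          ∫ s, ((s - shat i₁ ℓ) ^ 2 - (s - shat i₁ (ℓ + 1)) ^ 2) *
            ∫ x₁ in cell (T + 1) t i₁, f s x₁ (t ℓ))
        + ∑ i₂ ∈ Finset.Icc 1 (T + 1),
            ∫ s, ((s - shat ℓ i₂) ^ 2 - (s - shat (ℓ + 1) i₂) ^ 2) *
              ∫ x₂ in cell (T + 1) t i₂, f s (t ℓ) x₂)
      (t ℓ) := by
  obtain ⟨ε, hε, M, hM, hdomℓ⟩ := hdom ℓ hℓ1 hℓ2
  have hw : ∀ c : ℝ, Measurable fun s : ℝ => (s - c) ^ 2 := fun c => by fun_prop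
  have hwf : ∀ c : ℝ, Integrable fun p : ℝ × ℝ × ℝ => (p.1 - c) ^ 2 * f p.1 p.2.1 p.2.2 :=
    integrable_sub_sq_mul measurable_fst.aestronglyMeasurable hf_int
  have hMw : ∀ c : ℝ, Integrable fun p : ℝ × ℝ => (p.1 - c) ^ 2 * M p.1 p.2 :=
    integrable_sub_sq_mul measurable_fst.aestronglyMeasurable hM
  have hnear : |t ℓ - t ℓ| < ε := by simpa using hε
  have hright : ∀ c i, Integrable fun s => (s - c) ^ 2 * ∫ x in cell (T + 1) t i, f s x (t ℓ) :=
    fun c i => integrable_mul_setIntegral (g := fun s x => f s x (t ℓ)) (measurableSet_cell _ _ _)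
      (integrable_mul_of_dominated
        (hf_meas.comp (by fun_prop : Measurable fun p : ℝ × ℝ => (p.1, p.2, t ℓ)))
        (fun _ _ => hf_nonneg _ _ _) (hw c) (hMw c) fun s x => (hdomℓ s x _ hnear).1)
  have hleft : ∀ c i, Integrable fun s => (s - c) ^ 2 * ∫ x in cell (T + 1) t i, f s (t ℓ) x :=
    fun c i => integrable_mul_setIntegral (g := fun s x => f s (t ℓ) x) (measurableSet_cell _ _ _)
      (integrable_mul_of_dominated
        (hf_meas.comp (by fun_prop : Measurable fun p : ℝ × ℝ => (p.1, t ℓ, p.2)))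
        (fun _ _ => hf_nonneg _ _ _) (hw c) (hMw c) fun s x => (hdomℓ s x _ hnear).2)
  have hderiv := HasDerivAt.fun_sum fun i (hi : i ∈ Finset.Icc 1 (T + 1)) =>
    HasDerivAt.fun_sum fun j (hj : j ∈ Finset.Icc 1 (T + 1)) =>
      hasDerivAt_integral_cell ht hℓ1 hℓ2 (Finset.mem_Icc.1 hi).1 (Finset.mem_Icc.1 hj).1
        hf_meas hf_nonneg hcont (hw (shat i j)) (hwf _) (hMw _) hε hdomℓ
  refine hderiv.congr_deriv (Eq.symm ?_)
  simp only [Finset.sum_add_distrib]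
  congr 1
  · refine Finset.sum_congr rfl fun i _ => ?_
    rw [sum_cellSign_mul hℓ1 hℓ2 fun j =>
      ∫ s, (s - shat i j) ^ 2 * ∫ x in cell (T + 1) t i, f s x (t ℓ),
      ← integral_sub (hright _ _) (hright _ _)]
    simp only [sub_mul]
  · rw [Finset.sum_comm]
    refine Finset.sum_congr rfl fun j _ => ?_
    rw [sum_cellSign_mul hℓ1 hℓ2 fun i =>
      ∫ s, (s - shat i j) ^ 2 * ∫ y in cell (T + 1) t j, f s (t ℓ) y,
      ← integral_sub (hleft _ _) (hleft _ _)]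
    simp only [sub_mul]
end
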